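/- arXiv:2310.06767 — 3 statements merged into one kernel-verified Lean document; each statement's English description precedes it below -/
import Mathlib

section
/- Let |ψ_θ⟩ be a one-parameter family of unit vectors in ℂ^d, differentiable in θ, normalized so that ⟨ψ̇_θ|ψ_θ⟩ = 0 where ψ̇_θ = dψ_θ/dθ, and let {|v_0⟩, …, |v_{d−1}⟩} be an orthonormal basis of ℂ^d with phases chosen so that ⟨v_i|ψ_θ⟩ ∈ ℝ for all i. Then the projective measurement in this basis satisfies I(θ) = F(θ) = 4‖ψ̇_θ‖² if and only if: (1) ⟨v_i|ψ̇_θ⟩ ∈ ℝ for every i with ⟨v_i|ψ_θ⟩ ≠ 0; and (2) ⟨v_i|ψ̇_θ⟩ = 0 for every i with ⟨v_i|ψ_θ⟩ = 0. -/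
open scoped BigOperators ENNReal NNReal ComplexOrder
open Filter MeasureTheory Matrix Topology

namespace Stmt1
theorem pure_state_qcrb_saturation_iff
    {d : ℕ}
    (ψ : ℝ → EuclideanSpace ℂ (Fin d)) (θ : ℝ)
    (hψnorm : ∀ t, ‖ψ t‖ = 1)
    (ψ' : EuclideanSpace ℂ (Fin d))
    (hψ' : HasDerivAt ψ ψ' θ)
    (hphase : inner (𝕜 := ℂ) ψ' (ψ θ) = 0)
    (v : Fin d → EuclideanSpace ℂ (Fin d))
    (hv : Orthonormal ℂ v)
    (hreal : ∀ i, (inner (𝕜 := ℂ) (v i) (ψ θ)).im = 0)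
    (prob : Fin d → ℝ → ℝ)
    (hprob : ∀ i t, prob i t = ‖inner (𝕜 := ℂ) (v i) (ψ t)‖ ^ 2)
    (prob' : Fin d → ℝ)
    (hprob' : ∀ i, HasDerivAt (prob i) (prob' i) θ)
    (I F : ℝ)
    (hI : I = ∑ i ∈ Finset.univ.filter (fun i => 0 < prob i θ),
        (prob i θ)⁻¹ * (prob' i) ^ 2)
    (hF : F = 4 * ‖ψ'‖ ^ 2) :
    I = F ↔
      ((∀ i, inner (𝕜 := ℂ) (v i) (ψ θ) ≠ 0 → (inner (𝕜 := ℂ) (v i) ψ').im = 0) ∧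
       (∀ i, inner (𝕜 := ℂ) (v i) (ψ θ) = 0 → inner (𝕜 := ℂ) (v i) ψ' = 0)) := by
  have hspan : ⊤ ≤ Submodule.span ℂ (Set.range v) :=
    (hv.linearIndependent.span_eq_top_of_card_eq_finrank' (by simp)).ge
  let b : OrthonormalBasis (Fin d) ℂ (EuclideanSpace ℂ (Fin d)) := OrthonormalBasis.mk hv hspan
  have hb : ∀ i, b i = v i := fun i => by simp [b]
  have hpars : ∑ i, ‖inner (𝕜 := ℂ) (v i) ψ'‖ ^ 2 = ‖ψ'‖ ^ 2 := by
    rw [← b.sum_sq_norm_inner_right ψ']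
    simp only [hb]
  have hp' : ∀ i, prob' i =
      2 * ((inner (𝕜 := ℂ) (v i) (ψ θ)).re * (inner (𝕜 := ℂ) (v i) ψ').re) := by
    intro i
    have h1 : HasDerivAt (fun t => inner (𝕜 := ℂ) (v i) (ψ t)) (inner (𝕜 := ℂ) (v i) ψ') θ := by
      simpa using (hasDerivAt_const θ (v i)).inner ℂ hψ'
    have h2 := h1.norm_sq
    have h3 : prob i = fun t => ‖inner (𝕜 := ℂ) (v i) (ψ t)‖ ^ 2 := funext (hprob i)
    have h4 := hprob' i
    rw [h3] at h4
    rw [h4.unique h2, Complex.inner]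
    rw [Complex.mul_re, Complex.conj_re, Complex.conj_im, hreal i]
    ring
  have key : ∀ i, (if 0 < prob i θ then (prob i θ)⁻¹ * (prob' i) ^ 2 else 0) =
      if inner (𝕜 := ℂ) (v i) (ψ θ) = 0 then 0 else 4 * (inner (𝕜 := ℂ) (v i) ψ').re ^ 2 := by
    intro i
    by_cases h : inner (𝕜 := ℂ) (v i) (ψ θ) = 0
    · simp [hprob, h]
    · have hpos : 0 < prob i θ := by
        rw [hprob]
        have := norm_pos_iff.mpr h
        positivity
      rw [if_pos hpos, if_neg h, hp']
      have hsq : prob i θ = (inner (𝕜 := ℂ) (v i) (ψ θ)).re ^ 2 := by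
        rw [hprob, Complex.sq_norm, Complex.normSq_apply, hreal i]
        ring
      rw [hsq] at hpos ⊢
      have hne : (inner (𝕜 := ℂ) (v i) (ψ θ)).re ≠ 0 := by
        intro h0
        simp [h0] at hpos
      field_simp
      ring
  have hns : ∀ z : ℂ, ‖z‖ ^ 2 = z.re ^ 2 + z.im ^ 2 := by
    intro z
    rw [Complex.sq_norm, Complex.normSq_apply]
    ring
  rw [hI, hF, ← hpars, Finset.sum_filter, Finset.mul_sum, Finset.sum_congr rfl (fun i _ => key i),
    Finset.sum_eq_sum_iff_of_le]
  · constructor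
    · intro H
      refine ⟨fun i hi => ?_, fun i hi => ?_⟩
      · have := H i (Finset.mem_univ i)
        rw [if_neg hi, hns] at this
        have h0 : (inner (𝕜 := ℂ) (v i) ψ').im ^ 2 = 0 := by linarith
        exact pow_eq_zero_iff two_ne_zero |>.mp h0
      · have := H i (Finset.mem_univ i)
        rw [if_pos hi] at this
        have h0 : ‖inner (𝕜 := ℂ) (v i) ψ'‖ ^ 2 = 0 := by linarith
        exact norm_eq_zero.mp (pow_eq_zero_iff two_ne_zero |>.mp h0)
    · rintro ⟨H1, H2⟩ i -
      split_ifs with h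
      · simp [H2 i h]
      · rw [hns, H1 i h]
        ring
  · intro i _
    split_ifs with h
    · positivity
    · rw [hns]
      nlinarith [sq_nonneg (inner (𝕜 := ℂ) (v i) ψ').im]
end Stmt1
end

section
/- Let |ψ_θ⟩ be a one-parameter family of unit vectors in ℂ^d, differentiable in θ, with ⟨ψ̇_θ|ψ_θ⟩ = 0, and let {|v_0⟩, …, |v_{d−1}⟩} be an orthonormal basis with |v_0⟩ = |ψ_θ⟩ at the given point θ (an exact null measurement). Then: (i) every outcome probability p(i) : θ' ↦ |⟨v_i|ψ_{θ'}⟩|² has vanishing derivative at θ' = θ, so the classical Fisher information of this measurement at θ is zero; (ii) if moreover ψ̇_θ ≠ 0 then there exists i ≥ 1 with Tr(|v_i⟩⟨v_i| L_θ ρ_θ L_θ) = 4|⟨v_i|ψ̇_θ⟩|² ≠ 0, i.e. the exact null measurement violates condition (2) for saturation of the quantum Cramér–Rao bound. -/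
open scoped BigOperators ENNReal NNReal ComplexOrder
open Filter MeasureTheory Matrix Topology

namespace Stmt2
theorem exact_null_measurement
    {d : ℕ} [NeZero d]
    (ψ : ℝ → EuclideanSpace ℂ (Fin d)) (θ : ℝ)
    (hψnorm : ∀ t, ‖ψ t‖ = 1)
    (ψ' : EuclideanSpace ℂ (Fin d))
    (hψ' : HasDerivAt ψ ψ' θ)
    (hphase : inner (𝕜 := ℂ) ψ' (ψ θ) = 0)
    (v : Fin d → EuclideanSpace ℂ (Fin d))
    (hv : Orthonormal ℂ v)
    (hv0 : v 0 = ψ θ)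
    (prob : Fin d → ℝ → ℝ)
    (hprob : ∀ i t, prob i t = ‖inner (𝕜 := ℂ) (v i) (ψ t)‖ ^ 2)
    -- the SLD and the state as operators
    (Lop ρop : EuclideanSpace ℂ (Fin d) → EuclideanSpace ℂ (Fin d))
    (hLop : ∀ x, Lop x = (2 : ℂ) • ((inner (𝕜 := ℂ) (ψ θ) x) • ψ' + (inner (𝕜 := ℂ) ψ' x) • ψ θ))
    (hρop : ∀ x, ρop x = (inner (𝕜 := ℂ) (ψ θ) x) • ψ θ) :
    -- (i) all outcome probabilities have vanishing derivative at θ, so the CFI vanishes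
    (∀ i, HasDerivAt (prob i) 0 θ) ∧
    (∑ i ∈ Finset.univ.filter (fun i => 0 < prob i θ),
        (prob i θ)⁻¹ * (deriv (prob i) θ) ^ 2 = 0) ∧
    -- (ii) violation of condition (2) for saturation of the QCRB
    (ψ' ≠ 0 → ∃ i : Fin d, i ≠ 0 ∧
        inner (𝕜 := ℂ) (v i) (Lop (ρop (Lop (v i))))
          = (4 : ℂ) * (‖inner (𝕜 := ℂ) (v i) ψ'‖ ^ 2 : ℝ) ∧
        (4 : ℝ) * ‖inner (𝕜 := ℂ) (v i) ψ'‖ ^ 2 ≠ 0) := by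
  have hphase2 : inner (𝕜 := ℂ) (ψ θ) ψ' = 0 := inner_eq_zero_symm.mp hphase
  have hself : inner (𝕜 := ℂ) (ψ θ) (ψ θ) = 1 := by
    rw [inner_self_eq_norm_sq_to_K, hψnorm]; simp
  have hort : ∀ i, i ≠ 0 → inner (𝕜 := ℂ) (v i) (ψ θ) = 0 := by
    intro i hi
    rw [← hv0]; exact hv.2 hi
  have hD : ∀ i, HasDerivAt (prob i) 0 θ := by
    intro i
    have hf : HasDerivAt (fun t => inner (𝕜 := ℂ) (v i) (ψ t)) (inner (𝕜 := ℂ) (v i) ψ') θ := by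
      simpa using (hasDerivAt_const θ (v i)).inner ℂ hψ'
    have h2 := hf.norm_sq
    have he : prob i = fun t => ‖inner (𝕜 := ℂ) (v i) (ψ t)‖ ^ 2 := funext (hprob i)
    rw [he]
    convert h2 using 1
    by_cases hi : i = 0
    · subst hi
      rw [hv0, hphase2]; simp
    · rw [hort i hi]; simp
  refine ⟨hD, ?_, ?_⟩
  · apply Finset.sum_eq_zero
    intro i _
    rw [(hD i).deriv]; simp
  · intro hne
    have hex : ∃ i, inner (𝕜 := ℂ) (v i) ψ' ≠ 0 := by
      by_contra! hall
      apply hne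
      let b := basisOfOrthonormalOfCardEqFinrank hv (by simp)
      refine InnerProductSpace.ext_inner_left_basis (𝕜 := ℂ) b (fun i => ?_)
      simp [b, hall i]
    obtain ⟨i, hi⟩ := hex
    have hi0 : i ≠ 0 := by
      rintro rfl
      exact hi (by rw [hv0, hphase2])
    refine ⟨i, hi0, ?_, ?_⟩
    · have h1 : inner (𝕜 := ℂ) (ψ θ) (v i) = 0 := inner_eq_zero_symm.mp (hort i hi0)
      have h3 : inner (𝕜 := ℂ) ψ' (v i) * inner (𝕜 := ℂ) (v i) ψ'
          = ((‖inner (𝕜 := ℂ) (v i) ψ'‖ ^ 2 : ℝ) : ℂ) := by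
        rw [← inner_conj_symm ψ' (v i), Complex.conj_mul']
        push_cast; rfl
      rw [← h3, hLop (v i), hρop, hLop]
      simp only [h1, zero_smul, zero_add, inner_smul_right, hself, hphase, mul_one, mul_zero,
        add_zero]
      ring
    · have := norm_pos_iff.mpr hi
      positivity
end Stmt2
end

section
/- Let Θ ⊂ ℝ be a bounded interval and fix 0 < ε < 1/10. Let θ ∈ Θ, and let θ̃_n be a Θ-valued preliminary estimator (from ñ = n^{1−ε} copies) satisfying the concentration bound P_θ(|θ̃_n − θ| > n^{−1/2+ε}) ≤ C e^{−n^ε r} for some constants C, r > 0. Set θ'_n = θ̃_n + n^{−1/2+3ε}. Conditionally on θ̃_n, let X_1, …, X_n be i.i.d. {0,1}-valued random variables with P(X = 1) = sin²(θ − θ'_n), let p̂_n = |{i : X_i = 1}|/n, and define θ̂_n = θ̃_n + n^{−1/2+3ε}/2 − n^{1/2−3ε} p̂_n / 2. Then lim_{n→∞} n E_θ[(θ̂_n − θ)²] = 1/4 = F(θ)^{−1}, and √n(θ̂_n − θ) converges in distribution to the Gaussian N(0, 1/4). -/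
open scoped BigOperators ENNReal NNReal ComplexOrder
open Filter MeasureTheory Matrix Topology

namespace Stmt6

/-- The displaced-null estimator
`θ̂_n = θ̃_n + n^{−1/2+3ε}/2 − n^{1/2−3ε} p̂_n / 2`. -/
noncomputable def estimator (ε : ℝ) (n : ℕ) (ω : ℝ × (Fin n → Bool)) : ℝ :=
  ω.1 + (n : ℝ) ^ (-(1:ℝ) / 2 + 3 * ε) / 2
    - (n : ℝ) ^ ((1:ℝ) / 2 - 3 * ε)
        * (((Finset.univ.filter fun i => ω.2 i = true).card : ℝ) / n) / 2

/-- Binomial-type weighted sum over bit strings. -/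
noncomputable def bsum {E : Type*} [AddCommGroup E] [Module ℝ E] (w : Bool → ℝ) (n : ℕ) (g : ℕ → E) : E :=
  ∑ x : Fin n → Bool, (∏ i, w (x i)) • g (Finset.univ.filter fun i => x i = true).card

lemma bsum_zero {E : Type*} [AddCommGroup E] [Module ℝ E] (w : Bool → ℝ) (g : ℕ → E) :
    bsum w 0 g = g 0 := by
  simp [bsum]

lemma card_cons {n : ℕ} (b : Bool) (x : Fin n → Bool) :
    (Finset.univ.filter fun i : Fin (n + 1) => (Fin.cons b x : Fin (n + 1) → Bool) i = true).card
      = (if b = true then 1 else 0) + (Finset.univ.filter fun i => x i = true).card := by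
  simp only [Finset.card_filter, Fin.sum_univ_succ, Fin.cons_zero, Fin.cons_succ]

lemma bsum_succ {E : Type*} [AddCommGroup E] [Module ℝ E] (w : Bool → ℝ) (n : ℕ) (g : ℕ → E) :
    bsum w (n + 1) g = w true • bsum w n (fun k => g (k + 1)) + w false • bsum w n g := by
  unfold bsum
  rw [← (Fin.consEquiv (fun _ : Fin (n+1) => Bool)).sum_comp, Fintype.sum_prod_type]
  simp only [Fintype.sum_bool, Finset.smul_sum, smul_smul]
  congr 1
  · refine Finset.sum_congr rfl fun x _ => ?_
    simp only [Fin.consEquiv, Equiv.coe_fn_mk, Fin.prod_univ_succ, Fin.cons_zero, Fin.cons_succ]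
    exact congrArg _ (congrArg g ((card_cons true x).trans (by simp [add_comm])))
  · refine Finset.sum_congr rfl fun x _ => ?_
    simp only [Fin.consEquiv, Equiv.coe_fn_mk, Fin.prod_univ_succ, Fin.cons_zero, Fin.cons_succ]
    exact congrArg _ (congrArg g ((card_cons false x).trans (by simp)))

lemma bsum_sq (w : Bool → ℝ) (hw : w true + w false = 1) (n : ℕ) (a d : ℝ) :
    bsum w n (fun k => (a - d * k) ^ 2)
      = (a - d * n * w true) ^ 2 + d ^ 2 * n * w true * (1 - w true) := by
  have hf : w false = 1 - w true := by linarith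
  induction n generalizing a with
  | zero => simp [bsum_zero]
  | succ n ih =>
    rw [bsum_succ, ih]
    have : (fun k : ℕ => (a - d * ((k + 1 : ℕ) : ℝ)) ^ 2) = fun k : ℕ => ((a - d) - d * k) ^ 2 := by
      funext k; push_cast; ring
    rw [this, ih, hf]
    simp only [smul_eq_mul]; push_cast; ring

lemma bsum_pow (w : Bool → ℝ) (n : ℕ) (c z : ℂ) :
    bsum w n (fun k => c * z ^ k) = c * (w false + w true * z) ^ n := by
  induction n generalizing c with
  | zero => simp [bsum_zero]
  | succ n ih =>
    rw [bsum_succ, ih]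
    have : (fun k : ℕ => c * z ^ (k + 1)) = fun k : ℕ => (c * z) * z ^ k := by
      funext k; ring
    rw [this, ih]
    simp only [Complex.real_smul]; ring

lemma disint {E : Type*} [NormedAddCommGroup E] [NormedSpace ℝ E] {n : ℕ}
    (P : Measure (ℝ × (Fin n → Bool))) [IsProbabilityMeasure P]
    (w : ℝ → Bool → ℝ) (hw0 : ∀ t b, 0 ≤ w t b) (hwm : ∀ b, Measurable fun t => w t b)
    (hcond : ∀ B : Set ℝ, MeasurableSet B → ∀ x : Fin n → Bool,
      P (B ×ˢ {x}) = ∫⁻ t in B, ∏ i, ENNReal.ofReal (w t (x i)) ∂(P.map Prod.fst))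
    (F : ℝ × (Fin n → Bool) → E) (hF : Integrable F P) :
    ∫ ω, F ω ∂P = ∫ t, ∑ x : Fin n → Bool, (∏ i, w t (x i)) • F (t, x) ∂(P.map Prod.fst) := by
  set W : (Fin n → Bool) → ℝ → ℝ≥0∞ := fun x t => ∏ i, ENNReal.ofReal (w t (x i)) with hW
  have hWm : ∀ x, Measurable (W x) := fun x =>
    Finset.measurable_prod _ fun i _ => (hwm (x i)).ennreal_ofReal
  have hWr : ∀ x t, (W x t).toReal = ∏ i, w t (x i) := by
    intro x t
    simp [hW, ENNReal.toReal_prod, ENNReal.toReal_ofReal, hw0]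
  have hWt : ∀ x, ∀ᵐ t ∂(P.map Prod.fst), W x t < ⊤ := fun x => Eventually.of_forall fun t =>
    ENNReal.prod_lt_top fun i _ => ENNReal.ofReal_lt_top
  have hmk : ∀ x : Fin n → Bool, Measurable (fun t : ℝ => (t, x)) := fun x => by fun_prop
  have hemb : ∀ x : Fin n → Bool, MeasurableEmbedding (fun t : ℝ => (t, x)) := fun x =>
    measurableEmbedding_prod_mk_right x
  have key : P = ∑ x : Fin n → Bool, ((P.map Prod.fst).withDensity (W x)).map (fun t => (t, x)) := by
    ext s hs
    rw [Measure.finsetSum_apply]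
    have h1 : s = ⋃ x ∈ (Finset.univ : Finset (Fin n → Bool)), ((fun t : ℝ => (t, x)) ⁻¹' s) ×ˢ {x} := by
      ext ⟨t, y⟩; simp
    conv_lhs => rw [h1]
    rw [measure_biUnion_finset]
    · refine Finset.sum_congr rfl fun x _ => ?_
      rw [hcond _ (hmk x hs), Measure.map_apply (hmk x) hs, withDensity_apply _ (hmk x hs)]
    · intro x _ y _ hxy
      rw [Function.onFun, Set.disjoint_left]
      rintro ⟨t, z⟩ ⟨_, h2⟩ ⟨_, h3⟩
      exact hxy (h2.symm.trans h3)
    · intro x _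
      exact (hmk x hs).prod (measurableSet_singleton x)
  have hFx : ∀ x : Fin n → Bool, Integrable F (((P.map Prod.fst).withDensity (W x)).map (fun t => (t, x))) := by
    have := hF
    rw [key] at this
    intro x
    exact (integrable_finsetSum_measure.1 this) x (Finset.mem_univ x)
  have e1 : ∫ ω, F ω ∂P = ∑ x : Fin n → Bool, ∫ ω, F ω ∂(((P.map Prod.fst).withDensity (W x)).map (fun t => (t, x))) := by
    conv_lhs => rw [key]
    exact integral_finsetSum_measure fun x _ => hFx x
  rw [e1, integral_finsetSum]
  · refine Finset.sum_congr rfl fun x _ => ?_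
    rw [(hemb x).integral_map, integral_withDensity_eq_integral_toReal_smul (hWm x) (hWt x)]
    simp [hWr]
  · intro x _
    have h := (hemb x).integrable_map_iff.1 (hFx x)
    have := (integrable_withDensity_iff_integrable_smul₀' (hWm x).aemeasurable (hWt x)).1 h
    simpa [hWr] using this

/-- Uniform-convergence filter on pairs. -/
def locF (θ ε : ℝ) : Filter (ℕ × ℝ) :=
  (atTop ×ˢ ⊤) ⊓ 𝓟 {x : ℕ × ℝ | |x.2 - θ| ≤ (x.1 : ℝ) ^ (-(1:ℝ) / 2 + ε)}

lemma locF_eventually {θ ε : ℝ} {Q : ℕ × ℝ → Prop} (h : ∀ᶠ x in locF θ ε, Q x) :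
    ∀ᶠ n : ℕ in atTop, ∀ t, |t - θ| ≤ (n : ℝ) ^ (-(1:ℝ) / 2 + ε) → Q (n, t) := by
  rw [locF, eventually_inf_principal, eventually_prod_iff] at h
  obtain ⟨pa, hpa, pb, hpb, h⟩ := h
  rw [eventually_top] at hpb
  filter_upwards [hpa] with n hn t ht
  exact h hn (hpb t) ht

lemma lim_lemma {E : Type*} [NormedAddCommGroup E] [NormedSpace ℝ E] [CompleteSpace E] {θ ε : ℝ}
    (μ : ℕ → Measure ℝ) (hμ : ∀ n, IsProbabilityMeasure (μ n))
    (g : ℕ → ℝ → E) (hg : ∀ n, AEStronglyMeasurable (g n) (μ n)) (c : E)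
    (hlim : Tendsto (fun x : ℕ × ℝ => g x.1 x.2) (locF θ ε) (𝓝 c))
    (M : ℕ → ℝ) (hM : ∀ᶠ n in atTop, ∀ᵐ t ∂(μ n), ‖g n t - c‖ ≤ M n)
    (b : ℕ → ℝ) (hb : ∀ n, μ n {t | (n : ℝ) ^ (-(1:ℝ) / 2 + ε) < |t - θ|} ≤ ENNReal.ofReal (b n))
    (hb0 : ∀ n, 0 ≤ b n) (hM0 : ∀ n, 0 ≤ M n)
    (hMb : Tendsto (fun n => M n * b n) atTop (𝓝 0)) :
    Tendsto (fun n => ∫ t, g n t ∂(μ n)) atTop (𝓝 c) := by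
  rw [Metric.tendsto_atTop']
  rw [Metric.tendsto_nhds] at hlim
  intro e he
  have h1 := locF_eventually (hlim (e/2) (by positivity))
  have h2 := (Metric.tendsto_nhds.1 hMb) (e/2) (by positivity)
  obtain ⟨N, hN⟩ := eventually_atTop.1 ((h1.and h2).and hM)
  refine ⟨N, fun n hn => ?_⟩
  obtain ⟨⟨h1, h2⟩, h3⟩ := hN n hn.le
  have := hμ n
  set A : Set ℝ := {t | (n : ℝ) ^ (-(1:ℝ) / 2 + ε) < |t - θ|} with hA
  have hAm : MeasurableSet A := measurableSet_lt (by fun_prop) (by fun_prop)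
  have hi : Integrable (fun t => g n t - c) (μ n) :=
    Integrable.of_bound ((hg n).sub aestronglyMeasurable_const) (M n) h3
  have hgi : Integrable (g n) (μ n) := by
    refine (hi.add (integrable_const c)).congr (Eventually.of_forall fun t => ?_)
    simp
  have e1 : ∫ t, g n t ∂(μ n) - c = ∫ t, (g n t - c) ∂(μ n) := by
    rw [integral_sub hgi (integrable_const c)]; simp
  rw [dist_eq_norm, e1]
  have hdom : ∀ᵐ t ∂(μ n), ‖g n t - c‖ ≤ e / 2 + A.indicator (fun _ => M n) t := by
    filter_upwards [h3] with t ht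
    by_cases hta : t ∈ A
    · simp only [hta, Set.indicator_of_mem]; linarith
    · have h4 : |t - θ| ≤ (n : ℝ) ^ (-(1:ℝ) / 2 + ε) := not_lt.1 hta
      have := h1 t h4
      rw [dist_eq_norm] at this
      simp only [hta, not_false_eq_true, Set.indicator_of_notMem]; linarith
  have hii : Integrable (A.indicator (fun _ => M n)) (μ n) := (integrable_const _).indicator hAm
  calc ‖∫ t, (g n t - c) ∂(μ n)‖ ≤ ∫ t, (e / 2 + A.indicator (fun _ => M n) t) ∂(μ n) :=
        norm_integral_le_of_norm_le ((integrable_const _).add hii) hdom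
    _ = e / 2 + (μ n).real A * M n := by
        rw [integral_add (integrable_const _) hii, integral_indicator_const _ hAm]; simp
    _ ≤ e / 2 + b n * M n := by
        have : (μ n).real A ≤ b n := ENNReal.toReal_le_of_le_ofReal (hb0 n) (hb n)
        gcongr
        exact hM0 n
    _ < e := by
        rw [dist_eq_norm, sub_zero, Real.norm_eq_abs] at h2
        have := le_abs_self (M n * b n)
        nlinarith

lemma sin_sq_bound (x : ℝ) : |Real.sin x ^ 2 - x ^ 2| ≤ x ^ 4 := by
  wlog hx : 0 ≤ x with H
  · have := H (-x) (by linarith)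
    simpa [Even.neg_pow (by decide : Even 4)] using this
  have h1 := Real.sin_le hx
  have h2 := Real.sin_ge_sub_cube hx
  have h3 : |Real.sin x - x| ≤ x ^ 3 / 6 := by
    rw [abs_le]; constructor <;> nlinarith [pow_nonneg hx 3]
  have h4 : |Real.sin x + x| ≤ 2 * x := by
    have := Real.abs_sin_le_abs (x := x)
    rw [abs_of_nonneg hx] at this
    rw [abs_le] at this ⊢
    constructor <;> linarith [this.1, this.2]
  have h5 : Real.sin x ^ 2 - x ^ 2 = (Real.sin x - x) * (Real.sin x + x) := by ring
  rw [h5, abs_mul]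
  calc _ ≤ x ^ 3 / 6 * (2 * x) := by gcongr
    _ ≤ x ^ 4 := by nlinarith [pow_nonneg hx 4]

lemma locF_mem (θ ε : ℝ) :
    ∀ᶠ x in locF θ ε, |x.2 - θ| ≤ (x.1 : ℝ) ^ (-(1:ℝ) / 2 + ε) :=
  mem_inf_of_right (mem_principal_self _)

lemma locF_fst (θ ε : ℝ) : Tendsto (fun x : ℕ × ℝ => (x.1 : ℝ)) (locF θ ε) atTop :=
  tendsto_natCast_atTop_atTop.comp (tendsto_fst.mono_left inf_le_left)

lemma locF_rpow (θ ε : ℝ) {a : ℝ} (ha : a < 0) :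
    Tendsto (fun x : ℕ × ℝ => (x.1 : ℝ) ^ a) (locF θ ε) (𝓝 0) := by
  have := (tendsto_rpow_neg_atTop (y := -a) (by linarith)).comp (locF_fst θ ε)
  simpa [Function.comp_def] using this

/-- displacement -/
noncomputable def disp (ε : ℝ) (n : ℕ) : ℝ := (n : ℝ) ^ (-(1:ℝ) / 2 + 3 * ε)

/-- success probability -/
noncomputable def prob (θ ε : ℝ) (n : ℕ) (t : ℝ) : ℝ := Real.sin (θ - (t + disp ε n)) ^ 2

/-- scaled conditional bias -/
noncomputable def bias (θ ε : ℝ) (n : ℕ) (t : ℝ) : ℝ :=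
  (t - θ) + disp ε n / 2 - prob θ ε n t / (2 * disp ε n)

lemma disp_pos {ε : ℝ} {n : ℕ} (hn : 0 < n) : 0 < disp ε n :=
  Real.rpow_pos_of_pos (by exact_mod_cast hn) _

lemma prob_nonneg (θ ε : ℝ) (n : ℕ) (t : ℝ) : 0 ≤ prob θ ε n t := sq_nonneg _

lemma prob_le_one (θ ε : ℝ) (n : ℕ) (t : ℝ) : prob θ ε n t ≤ 1 := Real.sin_sq_le_one _

lemma ev_pos (θ ε : ℝ) : ∀ᶠ x in locF θ ε, 0 < x.1 := by
  filter_upwards [(locF_fst θ ε).eventually_gt_atTop 0] with x hx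
  exact_mod_cast hx

lemma lim_disp {θ ε : ℝ} (hε : ε < 1 / 10) :
    Tendsto (fun x : ℕ × ℝ => disp ε x.1) (locF θ ε) (𝓝 0) :=
  locF_rpow θ ε (by linarith)

lemma lim_ratio {θ ε : ℝ} (hε0 : 0 < ε) :
    Tendsto (fun x : ℕ × ℝ => (θ - x.2) / disp ε x.1) (locF θ ε) (𝓝 0) := by
  refine squeeze_zero_norm' ?_ (locF_rpow θ ε (a := -(2 * ε)) (by linarith))
  filter_upwards [locF_mem θ ε, ev_pos θ ε] with x hx hn
  have hD := disp_pos (ε := ε) hn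
  have hN : (0:ℝ) < x.1 := by exact_mod_cast hn
  rw [Real.norm_eq_abs, abs_div, abs_of_pos hD, div_le_iff₀ hD, disp, ← Real.rpow_add hN, abs_sub_comm]
  rw [show -(2 * ε) + (-(1:ℝ) / 2 + 3 * ε) = -(1:ℝ) / 2 + ε by ring]
  exact hx

lemma prob_err {θ ε : ℝ} {n : ℕ} (hn : 0 < n) (t : ℝ) :
    |prob θ ε n t - (disp ε n) ^ 2 * ((θ - t) / disp ε n - 1) ^ 2|
      ≤ (disp ε n) ^ 4 * ((θ - t) / disp ε n - 1) ^ 4 := by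
  have hD := disp_pos (ε := ε) hn
  have := sin_sq_bound (θ - (t + disp ε n))
  have e : θ - (t + disp ε n) = disp ε n * ((θ - t) / disp ε n - 1) := by field_simp; ring
  rw [prob, ← mul_pow, ← mul_pow, ← e]
  exact this

lemma lim_prob_div {θ ε : ℝ} (hε0 : 0 < ε) (hε : ε < 1 / 10) :
    Tendsto (fun x : ℕ × ℝ => prob θ ε x.1 x.2 / (disp ε x.1) ^ 2) (locF θ ε) (𝓝 1) := by
  have hy := (lim_ratio (θ := θ) hε0).sub_const 1
  have hD := lim_disp (θ := θ) hε
  have h1 : Tendsto (fun x : ℕ × ℝ => prob θ ε x.1 x.2 / (disp ε x.1) ^ 2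
      - ((θ - x.2) / disp ε x.1 - 1) ^ 2) (locF θ ε) (𝓝 0) := by
    have h2 := (hD.pow 2).mul (hy.pow 4)
    norm_num at h2
    refine squeeze_zero_norm' ?_ h2
    filter_upwards [ev_pos θ ε] with x hn
    have hD := disp_pos (ε := ε) hn
    have hp := prob_err (θ := θ) (ε := ε) hn x.2
    have e : prob θ ε x.1 x.2 / (disp ε x.1) ^ 2 - ((θ - x.2) / disp ε x.1 - 1) ^ 2
      = (prob θ ε x.1 x.2 - (disp ε x.1) ^ 2 * ((θ - x.2) / disp ε x.1 - 1) ^ 2) / (disp ε x.1) ^ 2 := by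
      field_simp
    rw [e, Real.norm_eq_abs, abs_div, abs_of_pos (pow_pos hD 2), div_le_iff₀ (pow_pos hD 2)]
    refine hp.trans (le_of_eq ?_)
    ring
  have h3 := h1.add (hy.pow 2)
  norm_num at h3
  exact h3

lemma lim_prob {θ ε : ℝ} (hε0 : 0 < ε) (hε : ε < 1 / 10) :
    Tendsto (fun x : ℕ × ℝ => prob θ ε x.1 x.2) (locF θ ε) (𝓝 0) := by
  have h := (lim_prob_div (θ := θ) hε0 hε).mul ((lim_disp (θ := θ) hε).pow 2)
  norm_num at h
  refine h.congr' ?_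
  filter_upwards [ev_pos θ ε] with x hn
  have hD := disp_pos (ε := ε) hn
  field_simp

lemma lim_bias {θ ε : ℝ} (hε0 : 0 < ε) (hε : ε < 1 / 10) :
    Tendsto (fun x : ℕ × ℝ => √(x.1 : ℝ) * bias θ ε x.1 x.2) (locF θ ε) (𝓝 0) := by
  have hy := (lim_ratio (θ := θ) hε0).sub_const 1
  have h2 := (locF_rpow θ ε (a := -ε) (by linarith)).add
    ((locF_rpow θ ε (a := -1 + 9 * ε) (by linarith)).mul (hy.pow 4))
  norm_num at h2
  refine squeeze_zero_norm' ?_ h2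
  filter_upwards [locF_mem θ ε, ev_pos θ ε] with x hx hn
  have hD := disp_pos (ε := ε) hn
  have hp := prob_err (θ := θ) (ε := ε) hn x.2
  have hN : (0:ℝ) < x.1 := by exact_mod_cast hn
  set N : ℝ := (x.1 : ℝ)
  set D := disp ε x.1 with hDdef
  set u := θ - x.2 with hu
  have e : √N * bias θ ε x.1 x.2 = - (√N * u ^ 2 / (2 * D))
      - √N * (prob θ ε x.1 x.2 - D ^ 2 * (u / D - 1) ^ 2) / (2 * D) := by
    rw [bias, show x.2 - θ = - u by rw [hu]; ring, ← hDdef]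
    field_simp; ring
  have hs : √N = N ^ (1/2 : ℝ) := Real.sqrt_eq_rpow N
  have hs0 : 0 ≤ √N := Real.sqrt_nonneg N
  have b1 : |√N * u ^ 2 / (2 * D)| ≤ N ^ (-ε) := by
    have hu2 : u ^ 2 ≤ (N ^ (-(1:ℝ) / 2 + ε)) ^ 2 := by
      rw [abs_sub_comm] at hx
      exact sq_le_sq.2 (hx.trans (le_abs_self _))
    rw [abs_of_nonneg (by positivity), div_le_iff₀ (by positivity)]
    have : √N * (N ^ (-(1:ℝ) / 2 + ε)) ^ 2 = N ^ (-ε) * D := by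
      rw [hs, hDdef, disp, sq, ← Real.rpow_add hN, ← Real.rpow_add hN, ← Real.rpow_add hN]
      congr 1; ring
    have h3 := mul_le_mul_of_nonneg_left hu2 hs0
    have : 0 ≤ N ^ (-ε) * D := by positivity
    linarith
  have b2 : |√N * (prob θ ε x.1 x.2 - D ^ 2 * (u / D - 1) ^ 2) / (2 * D)|
      ≤ N ^ (-1 + 9 * ε) * (u / D - 1) ^ 4 := by
    rw [abs_div, abs_mul, abs_of_nonneg hs0, abs_of_pos (by positivity : 0 < 2 * D),
      div_le_iff₀ (by positivity)]
    have : √N * D ^ 3 = N ^ (-1 + 9 * ε) := by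
      rw [hs, hDdef, disp, ← Real.rpow_natCast, ← Real.rpow_mul hN.le, ← Real.rpow_add hN]
      congr 1; push_cast; ring
    have h3 := mul_le_mul_of_nonneg_left hp hs0
    refine h3.trans ?_
    rw [← this]
    have : 0 ≤ √N * D ^ 4 * (u / D - 1) ^ 4 := by positivity
    nlinarith
  rw [Real.norm_eq_abs, e]
  refine (abs_sub _ _).trans ?_
  rw [abs_neg]
  exact add_le_add b1 b2

lemma norm_pow_sub_pow_le' (z w : ℂ) (hz : ‖z‖ ≤ 1) (hw : ‖w‖ ≤ 1) (n : ℕ) :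
    ‖z ^ n - w ^ n‖ ≤ n * ‖z - w‖ := by
  induction n with
  | zero => simp
  | succ n ih =>
    have e : z ^ (n + 1) - w ^ (n + 1) = z ^ n * (z - w) + (z ^ n - w ^ n) * w := by ring
    rw [e]
    have h1 : ‖z ^ n‖ ≤ 1 := by rw [norm_pow]; exact pow_le_one₀ (norm_nonneg _) hz
    calc _ ≤ ‖z ^ n‖ * ‖z - w‖ + ‖z ^ n - w ^ n‖ * ‖w‖ := by
          refine (norm_add_le _ _).trans ?_
          rw [norm_mul, norm_mul]
      _ ≤ 1 * ‖z - w‖ + (n * ‖z - w‖) * 1 := by gcongr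
      _ = _ := by push_cast; ring

lemma char_bound (a p : ℝ) (ha : |a| ≤ 1 / 2) (hp0 : 0 ≤ p) (hp1 : p ≤ 1) (n : ℕ) :
    ‖((1 - p : ℝ) + (p : ℂ) * Complex.exp (((-a : ℝ) : ℂ) * Complex.I)) ^ n
      - Complex.exp (-(Complex.I * a * p) - a ^ 2 * p / 2) ^ n‖
      ≤ n * (p * |a| ^ 3 + 4 * a ^ 2 * p ^ 2) := by
  set y : ℂ := -(Complex.I * a * p) - a ^ 2 * p / 2 with hy
  have h1 : ‖((1 - p : ℝ) + (p : ℂ) * Complex.exp (((-a : ℝ) : ℂ) * Complex.I))‖ ≤ 1 := by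
    refine (norm_add_le _ _).trans ?_
    rw [norm_mul, Complex.norm_exp_ofReal_mul_I, Complex.norm_real, Complex.norm_real,
      Real.norm_eq_abs, Real.norm_eq_abs, abs_of_nonneg hp0, abs_of_nonneg (by linarith)]
    linarith
  have h2 : ‖Complex.exp y‖ ≤ 1 := by
    rw [Complex.norm_exp, Real.exp_le_one_iff]
    have : y = ((-(a ^ 2 * p / 2) : ℝ) : ℂ) + ((-(a * p) : ℝ) : ℂ) * Complex.I := by
      rw [hy]; push_cast; ring
    rw [this]
    have h0 : 0 ≤ a ^ 2 * p / 2 := by positivity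
    rw [Complex.add_re, Complex.ofReal_re, Complex.re_ofReal_mul, Complex.I_re]
    linarith
  refine (norm_pow_sub_pow_le' _ _ h1 h2 n).trans ?_
  gcongr
  have hyn : ‖y‖ ≤ 2 * |a| * p := by
    refine (norm_sub_le _ _).trans ?_
    simp [abs_of_nonneg hp0]
    have : a ^ 2 = |a| * |a| := by rw [← sq, sq_abs]
    rw [this]
    nlinarith [mul_nonneg (abs_nonneg a) hp0]
  have hy1 : ‖y‖ ≤ 1 := by nlinarith [abs_nonneg a]
  have h3 := Complex.norm_exp_sub_one_sub_id_le hy1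
  have h4 := Complex.exp_bound (x := ((-a : ℝ) : ℂ) * Complex.I) (by
    rw [norm_mul, Complex.norm_I, Complex.norm_real, Real.norm_eq_abs, abs_neg]; linarith) (n := 3) (by norm_num)
  have h5 : ‖Complex.exp (((-a : ℝ) : ℂ) * Complex.I) - (1 - a * Complex.I - a ^ 2 / 2)‖ ≤ |a| ^ 3 := by
    have e : (∑ m ∈ Finset.range 3, (((-a : ℝ) : ℂ) * Complex.I) ^ m / (m.factorial : ℂ))
        = (1 - a * Complex.I - a ^ 2 / 2) := by
      simp [Finset.sum_range_succ, Nat.factorial, mul_pow]; ring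
    rw [e] at h4
    refine h4.trans ?_
    rw [norm_mul, Complex.norm_I, Complex.norm_real, Real.norm_eq_abs, abs_neg]
    norm_num [Nat.factorial]
    have : 0 ≤ |a| ^ 3 := by positivity
    linarith
  have e : ((1 - p : ℝ) + (p : ℂ) * Complex.exp (((-a : ℝ) : ℂ) * Complex.I)) - Complex.exp y
      = p * (Complex.exp (((-a : ℝ) : ℂ) * Complex.I) - (1 - a * Complex.I - a ^ 2 / 2))
        - (Complex.exp y - 1 - y) := by
    rw [hy]; push_cast; ring
  rw [e]
  refine (norm_sub_le _ _).trans ?_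
  rw [norm_mul, Complex.norm_real, Real.norm_eq_abs, abs_of_nonneg hp0]
  have h6 : ‖y‖ ^ 2 ≤ 4 * a ^ 2 * p ^ 2 := by
    calc ‖y‖ ^ 2 ≤ (2 * |a| * p) ^ 2 := by gcongr
      _ = _ := by rw [mul_pow, mul_pow, sq_abs]; ring
  have h7 := mul_le_mul_of_nonneg_left h5 hp0
  linarith

/-- frequency scale -/
noncomputable def frq (s ε : ℝ) (n : ℕ) : ℝ := s / (2 * disp ε n * √(n : ℝ))

/-- conditional characteristic function -/
noncomputable def cchar (s θ ε : ℝ) (n : ℕ) (t : ℝ) : ℂ :=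
  Complex.exp (((s * (√(n : ℝ) * ((t - θ) + disp ε n / 2)) : ℝ) : ℂ) * Complex.I) *
    ((1 - prob θ ε n t : ℝ) + (prob θ ε n t : ℂ) * Complex.exp (((-frq s ε n : ℝ) : ℂ) * Complex.I)) ^ n

lemma lim_frq (s : ℝ) {θ ε : ℝ} (hε0 : 0 < ε) :
    Tendsto (fun x : ℕ × ℝ => frq s ε x.1) (locF θ ε) (𝓝 0) := by
  have := (locF_rpow θ ε (a := -(3 * ε)) (by linarith)).const_mul (s / 2)
  rw [mul_zero] at this
  refine this.congr' ?_
  filter_upwards [ev_pos θ ε] with x hn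
  have hN : (0:ℝ) < x.1 := by exact_mod_cast hn
  rw [frq, disp, Real.sqrt_eq_rpow, mul_assoc, ← Real.rpow_add hN, Real.rpow_neg hN.le]
  rw [show -(1:ℝ) / 2 + 3 * ε + 1 / 2 = 3 * ε by ring]
  have := (Real.rpow_pos_of_pos hN (3 * ε)).ne'
  field_simp

lemma frq_sq (s : ℝ) {ε : ℝ} {n : ℕ} (hn : 0 < n) :
    n * (frq s ε n) ^ 2 = s ^ 2 / 4 / (disp ε n) ^ 2 := by
  have hD := (disp_pos (ε := ε) hn).ne'
  have hN : (0:ℝ) < n := by exact_mod_cast hn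
  rw [frq, div_pow, mul_pow, Real.sq_sqrt hN.le]
  field_simp; ring

lemma lim_cchar (s : ℝ) {θ ε : ℝ} (hε0 : 0 < ε) (hε : ε < 1 / 10) :
    Tendsto (fun x : ℕ × ℝ => cchar s θ ε x.1 x.2) (locF θ ε)
      (𝓝 (Complex.exp (((-(s ^ 2 / 8) : ℝ) : ℂ)))) := by
  have hA1 := lim_prob_div (θ := θ) hε0 hε
  have hA3 := lim_prob (θ := θ) hε0 hε
  have hA2 := lim_bias (θ := θ) hε0 hε
  have ha := lim_frq s (θ := θ) hε0
  -- main term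
  have hmain : Tendsto (fun x : ℕ × ℝ => Complex.exp
      (((s * (√(x.1 : ℝ) * bias θ ε x.1 x.2) : ℝ) : ℂ) * Complex.I
        + ((-(s ^ 2 / 8 * (prob θ ε x.1 x.2 / (disp ε x.1) ^ 2)) : ℝ) : ℂ))) (locF θ ε)
      (𝓝 (Complex.exp (((-(s ^ 2 / 8) : ℝ) : ℂ)))) := by
    refine (Complex.continuous_exp.tendsto _).comp ?_
    have h1 := (Complex.continuous_ofReal.tendsto _).comp (hA2.const_mul s)
    have h2 := (Complex.continuous_ofReal.tendsto _).comp (hA1.const_mul (s ^ 2 / 8)).neg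
    have h3 := (h1.mul_const Complex.I).add h2
    simpa [Function.comp_def] using h3
  have herr : Tendsto (fun x : ℕ × ℝ => s ^ 2 / 4 * (prob θ ε x.1 x.2 / (disp ε x.1) ^ 2) *
      (|frq s ε x.1| + 4 * prob θ ε x.1 x.2)) (locF θ ε) (𝓝 0) := by
    have := (hA1.const_mul (s ^ 2 / 4)).mul (ha.abs.add (hA3.const_mul 4))
    simpa using this
  have hdiff : Tendsto (fun x : ℕ × ℝ => cchar s θ ε x.1 x.2 - Complex.exp
      (((s * (√(x.1 : ℝ) * bias θ ε x.1 x.2) : ℝ) : ℂ) * Complex.I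
        + ((-(s ^ 2 / 8 * (prob θ ε x.1 x.2 / (disp ε x.1) ^ 2)) : ℝ) : ℂ))) (locF θ ε) (𝓝 0) := by
    refine squeeze_zero_norm' ?_ herr
    have hsm : ∀ᶠ x in locF θ ε, |frq s ε x.1| < 1 / 2 := by
      have := ha.abs
      rw [abs_zero] at this
      exact this.eventually_lt_const (by norm_num)
    filter_upwards [hsm, ev_pos θ ε] with x hx hn
    have hD := disp_pos (ε := ε) hn
    have hN : (0:ℝ) < x.1 := by exact_mod_cast hn
    have hsN : 0 < √(x.1 : ℝ) := Real.sqrt_pos.2 hN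
    have hsq := frq_sq s (ε := ε) hn
    have hb := char_bound (frq s ε x.1) (prob θ ε x.1 x.2) hx.le (prob_nonneg _ _ _ _)
      (prob_le_one _ _ _ _) x.1
    have hphase : s * (√(x.1 : ℝ) * bias θ ε x.1 x.2)
        = s * (√(x.1 : ℝ) * ((x.2 - θ) + disp ε x.1 / 2)) - x.1 * (frq s ε x.1 * prob θ ε x.1 x.2) := by
      have hNs : (x.1 : ℝ) = √(x.1 : ℝ) * √(x.1 : ℝ) := (Real.mul_self_sqrt hN.le).symm
      have : (x.1 : ℝ) * frq s ε x.1 = s * √(x.1 : ℝ) / (2 * disp ε x.1) := by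
        rw [frq]
        nth_rewrite 1 [hNs]
        field_simp
      rw [← mul_assoc (x.1 : ℝ), this, bias]
      ring
    have hre : s ^ 2 / 8 * (prob θ ε x.1 x.2 / (disp ε x.1) ^ 2)
        = x.1 * ((frq s ε x.1) ^ 2 * prob θ ε x.1 x.2 / 2) := by
      have : x.1 * ((frq s ε x.1) ^ 2 * prob θ ε x.1 x.2 / 2)
        = (x.1 * (frq s ε x.1) ^ 2) * prob θ ε x.1 x.2 / 2 := by ring
      rw [this, hsq]; ring
    have hexp : Complex.exp
      (((s * (√(x.1 : ℝ) * bias θ ε x.1 x.2) : ℝ) : ℂ) * Complex.I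
        + ((-(s ^ 2 / 8 * (prob θ ε x.1 x.2 / (disp ε x.1) ^ 2)) : ℝ) : ℂ))
        = Complex.exp (((s * (√(x.1 : ℝ) * ((x.2 - θ) + disp ε x.1 / 2)) : ℝ) : ℂ) * Complex.I) *
          Complex.exp (-(Complex.I * (frq s ε x.1) * (prob θ ε x.1 x.2))
            - (frq s ε x.1 : ℂ) ^ 2 * (prob θ ε x.1 x.2) / 2) ^ x.1 := by
      rw [← Complex.exp_nat_mul, ← Complex.exp_add, hphase, hre]
      congr 1
      push_cast; ring
    rw [hexp, cchar, ← mul_sub, norm_mul, Complex.norm_exp_ofReal_mul_I, one_mul]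
    refine hb.trans (le_of_eq ?_)
    have e : (x.1 : ℝ) * (prob θ ε x.1 x.2 * |frq s ε x.1| ^ 3 + 4 * frq s ε x.1 ^ 2 * prob θ ε x.1 x.2 ^ 2)
      = (x.1 * (frq s ε x.1) ^ 2) * (prob θ ε x.1 x.2) * (|frq s ε x.1| + 4 * prob θ ε x.1 x.2) := by
      have : |frq s ε x.1| ^ 3 = frq s ε x.1 ^ 2 * |frq s ε x.1| := by
        rw [← sq_abs]; ring
      rw [this]; ring
    rw [e, hsq]; ring
  simpa using hdiff.add hmain

lemma lim_second {θ ε : ℝ} (hε0 : 0 < ε) (hε : ε < 1 / 10) :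
    Tendsto (fun x : ℕ × ℝ => x.1 * bias θ ε x.1 x.2 ^ 2
      + prob θ ε x.1 x.2 * (1 - prob θ ε x.1 x.2) / (4 * disp ε x.1 ^ 2)) (locF θ ε) (𝓝 (1 / 4)) := by
  have hA1 := lim_prob_div (θ := θ) hε0 hε
  have hA3 := lim_prob (θ := θ) hε0 hε
  have hA2 := lim_bias (θ := θ) hε0 hε
  have h := (hA2.pow 2).add ((hA1.mul (hA3.const_sub 1)).div_const 4)
  norm_num at h
  norm_num
  refine h.congr fun x => ?_
  rw [mul_pow, Real.sq_sqrt (Nat.cast_nonneg _)]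
  ring

lemma estimator_sub (θ ε : ℝ) {n : ℕ} (ω : ℝ × (Fin n → Bool)) :
    estimator ε n ω - θ = ((ω.1 - θ) + disp ε n / 2)
      - 1 / (2 * disp ε n * n) * ((Finset.univ.filter fun i => ω.2 i = true).card : ℝ) := by
  have h : (n : ℝ) ^ ((1:ℝ) / 2 - 3 * ε) = (disp ε n)⁻¹ := by
    rw [disp, ← Real.rpow_neg (Nat.cast_nonneg _)]
    congr 1; ring
  rw [estimator, h, ← disp]
  ring

lemma estimator_meas (ε : ℝ) (n : ℕ) : Measurable (estimator ε n) := by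
  have h : Measurable fun ω : ℝ × (Fin n → Bool) =>
      ((Finset.univ.filter fun i => ω.2 i = true).card : ℝ) :=
    (measurable_of_finite
      (fun x : Fin n → Bool => ((Finset.univ.filter fun i => x i = true).card : ℝ))).comp measurable_snd
  unfold estimator
  fun_prop

/-- outcome weights -/
noncomputable def wt (θ ε : ℝ) (n : ℕ) (t : ℝ) (b : Bool) : ℝ :=
  if b then Real.sin (θ - (t + (n : ℝ) ^ (-(1:ℝ) / 2 + 3 * ε))) ^ 2
    else Real.cos (θ - (t + (n : ℝ) ^ (-(1:ℝ) / 2 + 3 * ε))) ^ 2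

lemma wt_nonneg (θ ε : ℝ) (n : ℕ) (t : ℝ) (b : Bool) : 0 ≤ wt θ ε n t b := by
  unfold wt; split_ifs <;> positivity

lemma wt_meas (θ ε : ℝ) (n : ℕ) (b : Bool) : Measurable fun t => wt θ ε n t b := by
  cases b <;> simp only [wt] <;> simp <;> fun_prop

lemma wt_true (θ ε : ℝ) (n : ℕ) (t : ℝ) : wt θ ε n t true = prob θ ε n t := by
  simp [wt, prob, disp]

lemma wt_false (θ ε : ℝ) (n : ℕ) (t : ℝ) : wt θ ε n t false = 1 - prob θ ε n t := by
  simp [wt, prob, disp, Real.cos_sq']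

lemma prob_meas (θ ε : ℝ) (n : ℕ) : Measurable (prob θ ε n) := by
  unfold prob; fun_prop

lemma cchar_meas (s θ ε : ℝ) (n : ℕ) : Measurable (cchar s θ ε n) := by
  have := prob_meas θ ε n
  unfold cchar; fun_prop

lemma cchar_norm (s θ ε : ℝ) (n : ℕ) (t : ℝ) : ‖cchar s θ ε n t‖ ≤ 1 := by
  rw [cchar, norm_mul, Complex.norm_exp_ofReal_mul_I, one_mul, norm_pow]
  refine pow_le_one₀ (norm_nonneg _) ?_
  refine (norm_add_le _ _).trans ?_
  have h0 := prob_nonneg θ ε n t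
  have h1 := prob_le_one θ ε n t
  rw [norm_mul, Complex.norm_exp_ofReal_mul_I, Complex.norm_real, Complex.norm_real,
    Real.norm_eq_abs, Real.norm_eq_abs, abs_of_nonneg h0, abs_of_nonneg (by linarith)]
  linarith

lemma lim_tail {ε r : ℝ} (hε0 : 0 < ε) (hr : 0 < r) (k : ℝ) :
    Tendsto (fun n : ℕ => (n : ℝ) ^ k * Real.exp (-(n : ℝ) ^ ε * r)) atTop (𝓝 0) := by
  have h := ((tendsto_rpow_mul_exp_neg_mul_atTop_nhds_zero (k / ε) r hr).comp
    (tendsto_rpow_atTop hε0)).comp (tendsto_natCast_atTop_atTop (R := ℝ))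
  refine h.congr fun n => ?_
  simp only [Function.comp]
  rw [← Real.rpow_mul (Nat.cast_nonneg _), mul_div_cancel₀ _ hε0.ne']
  congr 2; ring

lemma second_bound {θ ε R : ℝ} (hR : 0 ≤ R) (hε0 : 0 < ε) (hε : ε < 1 / 10) {n : ℕ} (hn : 0 < n)
    {t : ℝ} (ht : |t - θ| ≤ R) :
    ‖(n * bias θ ε n t ^ 2 + prob θ ε n t * (1 - prob θ ε n t) / (4 * disp ε n ^ 2)) - 1 / 4‖
      ≤ ((R + 2) ^ 2 + 2) * (n : ℝ) ^ (3 : ℝ) := by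
  have hD := disp_pos (ε := ε) hn
  have hN : (1:ℝ) ≤ n := by exact_mod_cast hn
  have h0 := prob_nonneg θ ε n t
  have h1 := prob_le_one θ ε n t
  have hD1 : disp ε n ≤ 1 := Real.rpow_le_one_of_one_le_of_nonpos hN (by linarith)
  have hD2 : 1 / disp ε n ≤ n := by
    rw [disp, one_div, ← Real.rpow_neg (by positivity)]
    calc (n : ℝ) ^ (-(-(1:ℝ) / 2 + 3 * ε)) ≤ (n : ℝ) ^ (1 : ℝ) :=
          Real.rpow_le_rpow_of_exponent_le hN (by linarith)
      _ = n := Real.rpow_one _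
  have hD0 : 0 ≤ 1 / disp ε n := by positivity
  rw [show (3 : ℝ) = ((3 : ℕ) : ℝ) by norm_num, Real.rpow_natCast]
  have hq : 0 ≤ prob θ ε n t / (2 * disp ε n) ∧ prob θ ε n t / (2 * disp ε n) ≤ n := by
    refine ⟨by positivity, ?_⟩
    have : prob θ ε n t / (2 * disp ε n) = prob θ ε n t * (1 / disp ε n) / 2 := by field_simp
    rw [this]; nlinarith
  have hb : |bias θ ε n t| ≤ (R + 2) * n := by
    rw [abs_le] at ht ⊢
    unfold bias
    have : R * 1 ≤ R * n := by gcongr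
    constructor <;> linarith [ht.1, ht.2, hq.1, hq.2]
  have hb2 : bias θ ε n t ^ 2 ≤ ((R + 2) * n) ^ 2 := sq_le_sq' (abs_le.1 hb).1 (abs_le.1 hb).2
  have hv0 : 0 ≤ prob θ ε n t * (1 - prob θ ε n t) / (4 * disp ε n ^ 2) :=
    div_nonneg (mul_nonneg h0 (by linarith)) (by positivity)
  have hv1 : prob θ ε n t * (1 - prob θ ε n t) / (4 * disp ε n ^ 2) ≤ (n : ℝ) ^ 2 := by
    have e : prob θ ε n t * (1 - prob θ ε n t) / (4 * disp ε n ^ 2)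
      = (prob θ ε n t * (1 - prob θ ε n t) / 4) * (1 / disp ε n) ^ 2 := by field_simp
    rw [e]
    calc _ ≤ 1 * (n : ℝ) ^ 2 := by
          gcongr
          nlinarith
      _ = _ := one_mul _
  have h23 : (n : ℝ) ^ 2 ≤ (n : ℝ) ^ 3 := pow_le_pow_right₀ hN (by norm_num)
  have h3 : (1 : ℝ) ≤ (n : ℝ) ^ 3 := one_le_pow₀ hN
  have hm : (n : ℝ) * bias θ ε n t ^ 2 ≤ (R + 2) ^ 2 * (n : ℝ) ^ 3 := by
    calc (n : ℝ) * bias θ ε n t ^ 2 ≤ n * ((R + 2) * n) ^ 2 := by gcongr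
      _ = _ := by ring
  have hm0 : 0 ≤ (n : ℝ) * bias θ ε n t ^ 2 := by positivity
  rw [Real.norm_eq_abs, abs_le]
  have hR2 : 0 ≤ (R + 2) ^ 2 * (n : ℝ) ^ 3 := by positivity
  constructor <;> nlinarith

theorem displaced_null_qubit_optimal
    (Θ : Set ℝ) (hΘb : Bornology.IsBounded Θ) (hΘm : MeasurableSet Θ)
    (ε : ℝ) (hε0 : 0 < ε) (hε : ε < 1 / 10)
    (θ : ℝ) (hθ : θ ∈ Θ)
    -- joint law of (θ̃_n, X_1, …, X_n)
    (P : (n : ℕ) → Measure (ℝ × (Fin n → Bool)))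
    (hP : ∀ n, IsProbabilityMeasure (P n))
    -- θ̃_n is Θ-valued
    (hsupp : ∀ n, ((P n).map Prod.fst) Θᶜ = 0)
    -- concentration of the preliminary estimator
    (Cc r : ℝ) (hCc : 0 < Cc) (hr : 0 < r)
    (hconc : ∀ n : ℕ, ((P n).map Prod.fst) {t | (n : ℝ) ^ (-(1:ℝ) / 2 + ε) < |t - θ|}
        ≤ ENNReal.ofReal (Cc * Real.exp (-(n : ℝ) ^ ε * r)))
    -- conditionally on θ̃_n = t, the X_i are i.i.d. Bernoulli(sin²(θ − θ'_n)),
    -- θ'_n = t + n^{−1/2+3ε}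
    (hcond : ∀ n, ∀ B : Set ℝ, MeasurableSet B → ∀ x : Fin n → Bool,
      (P n) (B ×ˢ {x}) = ∫⁻ t in B,
        ∏ i, ENNReal.ofReal
          (if x i then Real.sin (θ - (t + (n : ℝ) ^ (-(1:ℝ) / 2 + 3 * ε))) ^ 2
           else Real.cos (θ - (t + (n : ℝ) ^ (-(1:ℝ) / 2 + 3 * ε))) ^ 2)
        ∂((P n).map Prod.fst)) :
    -- n E_θ[(θ̂_n − θ)²] → 1/4 = F(θ)⁻¹
    Tendsto (fun n : ℕ => (n : ℝ) * ∫ ω, (estimator ε n ω - θ) ^ 2 ∂(P n))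
      atTop (𝓝 (1 / 4)) ∧
    -- √n(θ̂_n − θ) → N(0, 1/4) in distribution
    (∀ f : BoundedContinuousFunction ℝ ℝ,
      Tendsto (fun n : ℕ => ∫ ω, f (Real.sqrt n * (estimator ε n ω - θ)) ∂(P n))
        atTop (𝓝 (∫ x, f x ∂(ProbabilityTheory.gaussianReal 0 (1/4 : ℝ≥0))))) := by
  have hμ : ∀ n, IsProbabilityMeasure ((P n).map Prod.fst) := fun n =>
    Measure.isProbabilityMeasure_map measurable_fst.aemeasurable
  obtain ⟨R, hR0, hR⟩ : ∃ R : ℝ, 0 ≤ R ∧ ∀ t ∈ Θ, |t - θ| ≤ R := by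
    obtain ⟨R, hR⟩ := Metric.isBounded_iff.1 hΘb
    refine ⟨R, (dist_nonneg).trans (hR hθ hθ), fun t ht => ?_⟩
    have := hR ht hθ
    rwa [Real.dist_eq] at this
  have hb0 : ∀ n : ℕ, 0 ≤ Cc * Real.exp (-(n : ℝ) ^ ε * r) := fun n => by positivity
  have hsuppμ : ∀ n, ∀ᵐ t ∂((P n).map Prod.fst), t ∈ Θ := fun n => by
    rw [ae_iff]; exact hsupp n
  have hsuppP : ∀ n, ∀ᵐ ω ∂(P n), ω.1 ∈ Θ := fun n =>
    ae_of_ae_map measurable_fst.aemeasurable (hsuppμ n)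
  constructor
  · have hlim := lim_lemma (θ := θ) (ε := ε) (fun n => (P n).map Prod.fst) hμ
      (fun n t => (n : ℝ) * bias θ ε n t ^ 2
        + prob θ ε n t * (1 - prob θ ε n t) / (4 * disp ε n ^ 2))
      (fun n => by
        have := prob_meas θ ε n
        have hbm : Measurable (bias θ ε n) := by unfold bias; fun_prop
        exact Measurable.aestronglyMeasurable (by fun_prop))
      (1 / 4) (lim_second hε0 hε)
      (fun n => ((R + 2) ^ 2 + 2) * (n : ℝ) ^ (3 : ℝ))
      (by
        filter_upwards [eventually_gt_atTop 0] with n hn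
        filter_upwards [hsuppμ n] with t ht
        exact second_bound hR0 hε0 hε hn (hR t ht))
      (fun n => Cc * Real.exp (-(n : ℝ) ^ ε * r)) hconc hb0 (fun n => by positivity)
      (by
        have := (lim_tail hε0 hr 3).const_mul (((R + 2) ^ 2 + 2) * Cc)
        rw [mul_zero] at this
        refine this.congr fun n => ?_
        ring)
    refine hlim.congr' ?_
    filter_upwards [eventually_gt_atTop 0] with n hn
    have := hP n
    have hD := disp_pos (ε := ε) hn
    have hN : (0:ℝ) < n := by exact_mod_cast hn
    have hint : Integrable (fun ω => (estimator ε n ω - θ) ^ 2) (P n) := by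
      refine Integrable.of_bound (C := (R + disp ε n / 2 + 1 / (2 * disp ε n * n) * n) ^ 2)
        (((estimator_meas ε n).sub_const θ).pow_const 2).aestronglyMeasurable ?_
      filter_upwards [hsuppP n] with ω hω
      rw [Real.norm_eq_abs, abs_of_nonneg (sq_nonneg _), estimator_sub]
      have hk : ((Finset.univ.filter fun i => ω.2 i = true).card : ℝ) ≤ n := by
        have := Finset.card_filter_le (Finset.univ : Finset (Fin n)) (fun i => ω.2 i = true)
        rw [Finset.card_univ, Fintype.card_fin] at this
        exact_mod_cast this
      have hk0 : (0:ℝ) ≤ ((Finset.univ.filter fun i => ω.2 i = true).card : ℝ) := Nat.cast_nonneg _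
      have hd : 0 ≤ 1 / (2 * disp ε n * n) := by positivity
      have h1 := mul_le_mul_of_nonneg_left hk hd
      have h2 := mul_nonneg hd hk0
      have h3 := abs_le.1 (hR _ hω)
      apply sq_le_sq' <;> linarith [h3.1, h3.2]
    rw [disint (P n) (wt θ ε n) (wt_nonneg θ ε n) (wt_meas θ ε n) (hcond n) _ hint,
      ← integral_const_mul]
    refine integral_congr_ae (Eventually.of_forall fun t => ?_)
    have hs := bsum_sq (wt θ ε n t) (by rw [wt_true, wt_false]; ring) n
      ((t - θ) + disp ε n / 2) (1 / (2 * disp ε n * n))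
    simp only [bsum] at hs
    simp only [estimator_sub]
    rw [hs, wt_true, bias]
    field_simp
    ring
  · have hmeas : ∀ n : ℕ, Measurable fun ω => √(n : ℝ) * (estimator ε n ω - θ) := fun n =>
      ((estimator_meas ε n).sub_const θ).const_mul _
    obtain ⟨ν, hν⟩ : ∃ ν : ℕ → ProbabilityMeasure ℝ, ∀ n, (ν n : Measure ℝ)
        = (P n).map (fun ω => √(n : ℝ) * (estimator ε n ω - θ)) :=
      ⟨fun n => ⟨(P n).map (fun ω => √(n : ℝ) * (estimator ε n ω - θ)),
        haveI := hP n
        Measure.isProbabilityMeasure_map (hmeas n).aemeasurable⟩, fun n => rfl⟩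
    obtain ⟨γ, hγ⟩ : ∃ γ : ProbabilityMeasure ℝ, (γ : Measure ℝ)
        = ProbabilityTheory.gaussianReal 0 (1/4 : ℝ≥0) :=
      ⟨⟨ProbabilityTheory.gaussianReal 0 (1/4 : ℝ≥0), inferInstance⟩, rfl⟩
    have hconv : Tendsto ν atTop (𝓝 γ) := by
      rw [ProbabilityMeasure.tendsto_iff_tendsto_charFun]
      intro s
      have hlim := lim_lemma (θ := θ) (ε := ε) (fun n => (P n).map Prod.fst) hμ
        (fun n t => cchar s θ ε n t) (fun n => (cchar_meas s θ ε n).aestronglyMeasurable)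
        _ (lim_cchar s hε0 hε) (fun _ => 2)
        (Eventually.of_forall fun n => Eventually.of_forall fun t => by
          refine (norm_sub_le _ _).trans ?_
          have h1 := cchar_norm s θ ε n t
          have h2 : ‖Complex.exp (((-(s ^ 2 / 8) : ℝ) : ℂ))‖ ≤ 1 := by
            rw [Complex.norm_exp_ofReal, Real.exp_le_one_iff]
            have : 0 ≤ s ^ 2 / 8 := by positivity
            linarith
          linarith)
        (fun n => Cc * Real.exp (-(n : ℝ) ^ ε * r)) hconc hb0 (fun n => by positivity)
        (by
          have := (lim_tail hε0 hr 0).const_mul (2 * Cc)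
          rw [mul_zero] at this
          refine this.congr fun n => ?_
          rw [Real.rpow_zero]
          ring)
      have hlimit : charFun (ProbabilityTheory.gaussianReal 0 (1/4 : ℝ≥0)) s
          = Complex.exp (((-(s ^ 2 / 8) : ℝ) : ℂ)) := by
        rw [ProbabilityTheory.charFun_gaussianReal]
        congr 1
        push_cast
        ring
      simp only [hν, hγ]
      rw [hlimit]
      refine hlim.congr' ?_
      filter_upwards [eventually_gt_atTop 0] with n hn
      have := hP n
      have hD := disp_pos (ε := ε) hn
      have hN : (0:ℝ) < n := by exact_mod_cast hn
      rw [charFun_apply_real, integral_map (hmeas n).aemeasurable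
        (Continuous.aestronglyMeasurable (by fun_prop))]
      have hFm : Measurable fun ω : ℝ × (Fin n → Bool) => Complex.exp ((s : ℂ) *
          ((√(n : ℝ) * (estimator ε n ω - θ) : ℝ) : ℂ) * Complex.I) := by
        have := hmeas n
        fun_prop
      have hint : Integrable (fun ω : ℝ × (Fin n → Bool) => Complex.exp ((s : ℂ) *
          ((√(n : ℝ) * (estimator ε n ω - θ) : ℝ) : ℂ) * Complex.I)) (P n) := by
        refine Integrable.of_bound (C := 1) hFm.aestronglyMeasurable (Eventually.of_forall fun ω => ?_)
        rw [← Complex.ofReal_mul, Complex.norm_exp_ofReal_mul_I]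
      rw [disint (P n) (wt θ ε n) (wt_nonneg θ ε n) (wt_meas θ ε n) (hcond n) _ hint]
      refine integral_congr_ae (Eventually.of_forall fun t => ?_)
      have hs := bsum_pow (wt θ ε n t) n
        (Complex.exp (((s * (√(n : ℝ) * ((t - θ) + disp ε n / 2)) : ℝ) : ℂ) * Complex.I))
        (Complex.exp (((-frq s ε n : ℝ) : ℂ) * Complex.I))
      rw [wt_true, wt_false] at hs
      simp only [cchar]
      rw [← hs, bsum]
      refine Finset.sum_congr rfl fun x _ => ?_
      congr 1
      rw [← Complex.exp_nat_mul, ← Complex.exp_add, estimator_sub]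
      congr 1
      have hfr : √(n : ℝ) * (1 / (2 * disp ε n * n)) * s = frq s ε n := by
        have hNs : (n : ℝ) = √(n : ℝ) * √(n : ℝ) := (Real.mul_self_sqrt hN.le).symm
        have hsN : 0 < √(n : ℝ) := Real.sqrt_pos.2 hN
        rw [frq]
        nth_rewrite 2 [hNs]
        field_simp
      rw [← hfr]
      push_cast
      ring
    rw [ProbabilityMeasure.tendsto_iff_forall_integral_tendsto] at hconv
    intro f
    have hf := hconv f
    simp only [hν, hγ] at hf
    refine hf.congr fun n => ?_
    exact integral_map (hmeas n).aemeasurable f.continuous.aestronglyMeasurable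

end Stmt6
end
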